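/- arXiv:2211.11477 — 2 statements merged into one kernel-verified Lean document; each statement's English description precedes it below -/
import Mathlib

section
/- Let I, J be integers with 0 < I < J ≤ (n−1)/2 and set K := J − I. Let α, β, γ, ᾱ, β̄, γ̄ be nonzero elements of F_{q^n}, and define (with x^{q^t} for t ∈ ℤ denoting the image of x under the t-th iterate of the Frobenius automorphism x ↦ x^q of F_{q^n}, exponents taken modulo n): A₁ := (β/β̄)^{q^{K−I}}·(ᾱ/α)^{q^{−I}} and B₂ := (γᾱ/(γ̄α))^{q^{−I}}. If A₁ = B₂^{q^K + 1} and B₂ is a (q^K − 1)-th power in F_{q^n}, then the F_q-subspaces U^{I,J,n}_{α,β,γ} and U^{I,J,n}_{ᾱ,β̄,γ̄} of F_{q^n}^4 are ΓL(4, q^n)-equivalent. -/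
namespace ScatteredSeq

/-- The vector `(x, y, x^{q^I} + α y^{q^J}, x^{q^J} + β y^{q^I} + γ y^{q^J})`. -/
def Uvec (q : ℕ) {Fqn : Type*} [Field Fqn] (α β γ : Fqn) (I J : ℕ) (x y : Fqn) :
    Fin 4 → Fqn :=
  ![x, y, x ^ q ^ I + α * y ^ q ^ J, x ^ q ^ J + β * y ^ q ^ I + γ * y ^ q ^ J]

/-- The underlying set of the `F_q`-subspace `U^{I,J,n}_{α,β,γ}` of `F_{q^n}^4`. -/
def Uset (q : ℕ) {Fqn : Type*} [Field Fqn] (α β γ : Fqn) (I J : ℕ) :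
    Set (Fin 4 → Fqn) :=
  {w | ∃ x y : Fqn, w = Uvec q α β γ I J x y}

/-- Two subsets of `F_{q^n}^4` are `ΓL(4, q^n)`-equivalent if one is the image of
the other under a map `w ↦ N · (σ w₁, σ w₂, σ w₃, σ w₄)ᵀ` with `σ` a field
automorphism of `F_{q^n}` and `N` an invertible `4 × 4` matrix over `F_{q^n}`. -/
def GammaLEquiv {Fqn : Type*} [Field Fqn] (U₁ U₂ : Set (Fin 4 → Fqn)) : Prop :=
  ∃ (σ : Fqn ≃+* Fqn) (N : Matrix (Fin 4) (Fin 4) Fqn), IsUnit N ∧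
    U₂ = (fun w => N.mulVec (fun i => σ (w i))) '' U₁

/-- `x^{q^t}` for `t ∈ ℤ`: the `t`-th iterate of the Frobenius of `F_{q^n}`,
exponents taken modulo `n`. -/
def fpow (q n : ℕ) {Fqn : Type*} [Field Fqn] (x : Fqn) (t : ℤ) : Fqn :=
  x ^ q ^ (t % (n : ℤ)).toNat

end ScatteredSeq

open ScatteredSeq Module

namespace ScatteredSeq

variable {q n : ℕ} {F : Type*} [Field F]

theorem pow_pow_mul_eq_self (h : ∀ x : F, x ^ q ^ n = x) (x : F) (k : ℕ) :
    x ^ q ^ (n * k) = x := by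
  induction k with
  | zero => simp
  | succ k ih => rw [Nat.mul_succ, pow_add, pow_mul, ih, h]

theorem pow_pow_congr (h : ∀ x : F, x ^ q ^ n = x) (x : F) {r s : ℕ} (hrs : r ≡ s [MOD n]) :
    x ^ q ^ r = x ^ q ^ s := by
  rw [← Nat.mod_add_div r n, ← Nat.mod_add_div s n, pow_add, pow_mul, pow_pow_mul_eq_self h,
    pow_add, pow_mul, pow_pow_mul_eq_self h, hrs]

theorem fpow_pow (h : ∀ x : F, x ^ q ^ n = x) (hn : 0 < n) (x : F) (t : ℤ) {s r : ℕ}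
    (hr : t + s = r) : fpow q n x t ^ q ^ s = x ^ q ^ r := by
  rw [fpow, ← pow_mul, ← pow_add]
  refine pow_pow_congr h x ((Int.natCast_modEq_iff).1 ?_)
  have hpos : 0 ≤ t % (n : ℤ) := Int.emod_nonneg _ (by exact_mod_cast hn.ne')
  rw [Nat.cast_add, Int.toNat_of_nonneg hpos, ← hr]
  exact (Int.mod_modEq t n).add_right _

theorem pow_pow_injective (h : ∀ x : F, x ^ q ^ n = x) {k : ℕ} (hk : k ≤ n) :
    Function.Injective fun x : F => x ^ q ^ k := fun x y hxy => by
  have := congrArg (· ^ q ^ (n - k)) hxy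
  simpa only [← pow_mul, ← pow_add, Nat.add_sub_cancel' hk, h] using this

/-- A diagonal change of coordinates `x ↦ a x`, `y ↦ b y` maps `Uset` to `Uset` as soon as the
coefficients are compatible. -/
theorem gammaLEquiv_of_diagonal {I J : ℕ} {α β γ α' β' γ' a b : F} (ha : a ≠ 0) (hb : b ≠ 0)
    (hα : a ^ q ^ I * α = α' * b ^ q ^ J) (hβ : a ^ q ^ J * β = β' * b ^ q ^ I)
    (hγ : a ^ q ^ J * γ = γ' * b ^ q ^ J) :
    GammaLEquiv (Uset q α β γ I J) (Uset q α' β' γ' I J) := by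
  have key (x y : F) : (Matrix.diagonal ![a, b, a ^ q ^ I, a ^ q ^ J]).mulVec
      (Uvec q α β γ I J x y) = Uvec q α' β' γ' I J (a * x) (b * y) := by
    ext i
    rw [Matrix.mulVec_diagonal]
    fin_cases i
    · simp [Uvec]
    · simp [Uvec]
    · simp only [Uvec, mul_pow]
      simp
      linear_combination y ^ q ^ J * hα
    · simp only [Uvec, mul_pow]
      simp
      linear_combination y ^ q ^ I * hβ + y ^ q ^ J * hγ
  refine ⟨RingEquiv.refl F, Matrix.diagonal ![a, b, a ^ q ^ I, a ^ q ^ J], ?_, ?_⟩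
  · rw [Matrix.isUnit_diagonal, Pi.isUnit_iff]
    intro i
    fin_cases i <;> simp [ha, hb]
  · ext w
    constructor
    · rintro ⟨x, y, rfl⟩
      refine ⟨_, ⟨a⁻¹ * x, b⁻¹ * y, rfl⟩, ?_⟩
      simp only [RingEquiv.refl_apply]
      rw [key, mul_inv_cancel_left₀ ha, mul_inv_cancel_left₀ hb]
    · rintro ⟨_, ⟨x, y, rfl⟩, rfl⟩
      exact ⟨a * x, b * y, key x y⟩

end ScatteredSeq

/-- Let 0 < I < J ≤ (n−1)/2, K := J − I, and let
α, β, γ, ᾱ, β̄, γ̄ ∈ F_{q^n}*.  With A₁ = (β/β̄)^{q^{K−I}}(ᾱ/α)^{q^{−I}} and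
B₂ = (γᾱ/(γ̄α))^{q^{−I}} (Frobenius exponents taken modulo n), if
A₁ = B₂^{q^K + 1} and B₂ is a (q^K − 1)-th power in F_{q^n}, then
U^{I,J,n}_{α,β,γ} and U^{I,J,n}_{ᾱ,β̄,γ̄} are ΓL(4, q^n)-equivalent. -/
theorem Uspaces_equivalent_of_power_condition
    (q n : ℕ) (Fq Fqn : Type*) [Field Fq] [Fintype Fq] [Field Fqn] [Algebra Fq Fqn]
    (hq : Fintype.card Fq = q) (hrank : Module.finrank Fq Fqn = n)
    (I J : ℕ) (hI : 0 < I) (hIJ : I < J) (hJn : 2 * J ≤ n - 1)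
    (α β γ α' β' γ' : Fqn)
    (hα : α ≠ 0) (hβ : β ≠ 0) (hγ : γ ≠ 0)
    (hα' : α' ≠ 0) (hβ' : β' ≠ 0) (hγ' : γ' ≠ 0)
    (K : ℕ) (hK : K = J - I)
    (A₁ B₂ : Fqn)
    (hA₁ : A₁ = fpow q n (β / β') ((K : ℤ) - (I : ℤ)) * fpow q n (α' / α) (-(I : ℤ)))
    (hB₂ : B₂ = fpow q n (γ * α' / (γ' * α)) (-(I : ℤ)))
    (hpow : A₁ = B₂ ^ (q ^ K + 1))
    (hroot : ∃ z : Fqn, B₂ = z ^ (q ^ K - 1)) :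
    GammaLEquiv (Uset q α β γ I J) (Uset q α' β' γ' I J) := by
  have hn : 0 < n := by omega
  have : Module.Finite Fq Fqn := Module.finite_of_finrank_pos (hrank ▸ hn)
  have : Finite Fqn := Module.finite_of_finite Fq
  have : Fintype Fqn := Fintype.ofFinite Fqn
  have hfrob (x : Fqn) : x ^ q ^ n = x := by
    rw [← hq, ← hrank, ← Module.card_eq_pow_finrank, FiniteField.pow_card]
  have hq0 : q ≠ 0 := hq ▸ Fintype.card_ne_zero
  obtain ⟨z, hz⟩ := hroot
  have hJ : J = I + K := by omega
  have hB : B₂ ^ q ^ I = γ * α' / (γ' * α) := by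
    rw [hB₂, fpow_pow hfrob hn _ _ (r := 0) (by simp)]
    simp
  have hA : A₁ ^ q ^ I = (β / β') ^ q ^ K * (α' / α) := by
    rw [hA₁, mul_pow, fpow_pow hfrob hn _ _ (r := K) (by simp),
      fpow_pow hfrob hn _ _ (r := 0) (by simp)]
    simp
  have hB0 : B₂ ≠ 0 := by
    rintro rfl
    rw [zero_pow (pow_ne_zero _ hq0)] at hB
    exact div_ne_zero (mul_ne_zero hγ hα') (mul_ne_zero hγ' hα) hB.symm
  have hz0 : z ≠ 0 := by
    rintro rfl
    have hqK : q ^ K - 1 ≠ 0 := by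
      have : 1 < q := hq ▸ Fintype.one_lt_card
      have := Nat.one_lt_pow (n := K) (by omega) this
      omega
    exact hB0 (by rw [hz, zero_pow hqK])
  have hzB : z ^ q ^ K = B₂ * z := by
    rw [hz, ← pow_succ, Nat.sub_add_cancel (Nat.one_le_pow _ _ (Nat.pos_of_ne_zero hq0))]
  have hzI0 : z ^ q ^ I ≠ 0 := pow_ne_zero _ hz0
  have hzJ : z ^ q ^ J = γ * α' / (γ' * α) * z ^ q ^ I := by
    rw [hJ, add_comm, pow_add, pow_mul, hzB, mul_pow, hB]
  have hzJK : (z ^ q ^ J) ^ q ^ K = (β / β') ^ q ^ K * (α' / α) * z ^ q ^ I := by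
    rw [← hA, hpow, ← mul_pow, ← pow_mul, hJ]
    rw [show q ^ (I + K) * q ^ K = q ^ K * q ^ K * q ^ I by ring, pow_mul, pow_mul, hzB, mul_pow,
      hzB, pow_succ, mul_assoc]
  set b : Fqn := ((z ^ q ^ I)⁻¹ * (α / α')) ^ q ^ (n - J) with hb
  have hbJ : b ^ q ^ J = (z ^ q ^ I)⁻¹ * (α / α') := by
    rw [hb, ← pow_mul, ← pow_add, Nat.sub_add_cancel (by omega), hfrob]
  have hb0 : b ≠ 0 := pow_ne_zero _ (mul_ne_zero (inv_ne_zero hzI0) (div_ne_zero hα hα'))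
  refine gammaLEquiv_of_diagonal (inv_ne_zero hz0) hb0 ?_ ?_ ?_
  · rw [hbJ, inv_pow]
    field_simp
  · refine pow_pow_injective hfrob (k := K) (by omega) ?_
    simp only
    rw [mul_pow, mul_pow, ← pow_mul b, ← pow_add, ← hJ, hbJ, inv_pow, inv_pow, hzJK, div_pow]
    have := pow_ne_zero (q ^ K) hβ
    have := pow_ne_zero (q ^ K) hβ'
    field_simp
  · rw [hbJ, inv_pow, hzJ]
    field_simp
end

section
/- The orthogonal complement of the F_q-subspace U^{I,J,n}_{α,β,γ} of F_{q^n}^4 with respect to the F_q-bilinear form B((x₀,x₁,x₂,x₃),(y₀,y₁,y₂,y₃)) := Tr_{q^n/q}(x₀y₃ + x₃y₀ − x₁y₂ − x₂y₁) equals {(x, y, β^{q^{n−I}}·x^{q^{n−I}} + γ^{q^{n−J}}·x^{q^{n−J}} − α^{q^{n−J}}·y^{q^{n−J}}, y^{q^{n−I}} − x^{q^{n−J}}) : x, y ∈ F_{q^n}}. -/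
open ScatteredSeq

/-- The trace of a finite extension of a finite field is invariant under powers of Frobenius. -/
theorem FiniteField.trace_pow_card_pow {K L : Type*} [Field K] [Fintype K] [Field L]
    [Algebra K L] [FiniteDimensional K L] (a : L) (k : ℕ) :
    Algebra.trace K L (a ^ Fintype.card K ^ k) = Algebra.trace K L a := by
  induction k generalizing a with
  | zero => simp
  | succ k ih =>
    rw [pow_succ, pow_mul]
    have h := Algebra.trace_eq_of_algEquiv (FiniteField.frobeniusAlgEquivOfAlgebraic K L)
      (a ^ Fintype.card K ^ k)
    rw [FiniteField.coe_frobeniusAlgEquivOfAlgebraic] at h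
    exact h.trans (ih a)

/-- The adjoint of `s ↦ s ^ q ^ k` for the trace form is `c ↦ c ^ q ^ (n - k)`. -/
theorem FiniteField.trace_pow_card_pow_mul {K L : Type*} [Field K] [Fintype K] [Field L]
    [Algebra K L] [FiniteDimensional K L] {k : ℕ} (hk : k ≤ Module.finrank K L) (s c : L) :
    Algebra.trace K L (s ^ Fintype.card K ^ k * c) =
      Algebra.trace K L (s * c ^ Fintype.card K ^ (Module.finrank K L - k)) := by
  have : Finite L := Module.finite_of_finite K
  have := Fintype.ofFinite L
  rw [← FiniteField.trace_pow_card_pow _ (Module.finrank K L - k), mul_pow, ← pow_mul,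
    ← pow_add, Nat.add_sub_cancel' hk, ← Module.card_eq_pow_finrank, FiniteField.pow_card]

theorem ScatteredSeq.trace_Uvec {K L : Type*} [Field K] [Fintype K] [Field L]
    [Algebra K L] [FiniteDimensional K L] {I J : ℕ} (hI : I ≤ Module.finrank K L)
    (hJ : J ≤ Module.finrank K L) (α β γ s t x y z w : L) :
    Algebra.trace K L (s * w + (s ^ Fintype.card K ^ J + β * t ^ Fintype.card K ^ I
        + γ * t ^ Fintype.card K ^ J) * x - t * z
        - (s ^ Fintype.card K ^ I + α * t ^ Fintype.card K ^ J) * y) =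
      Algebra.trace K L (s * (w - (y ^ Fintype.card K ^ (Module.finrank K L - I)
          - x ^ Fintype.card K ^ (Module.finrank K L - J))))
        - Algebra.trace K L (t * (z - ((β * x) ^ Fintype.card K ^ (Module.finrank K L - I)
          + (γ * x) ^ Fintype.card K ^ (Module.finrank K L - J)
          - (α * y) ^ Fintype.card K ^ (Module.finrank K L - J)))) := by
  simp only [mul_sub, mul_add, map_sub, map_add, ← FiniteField.trace_pow_card_pow_mul hI,
    ← FiniteField.trace_pow_card_pow_mul hJ, add_mul]
  rw [mul_right_comm β, mul_right_comm γ, mul_right_comm α, mul_comm _ (t ^ _),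
    mul_comm _ (t ^ _), mul_comm _ (t ^ _)]
  ring

theorem Algebra.eq_zero_of_trace_mul_eq_zero {K L : Type*} [Field K] [Field L] [Algebra K L]
    [FiniteDimensional K L] [Algebra.IsSeparable K L] {c : L}
    (h : ∀ s, Algebra.trace K L (s * c) = 0) : c = 0 :=
  (traceForm_nondegenerate K L).2 c h

/-- The orthogonal complement of U^{I,J,n}_{α,β,γ} ⊆ F_{q^n}^4
with respect to the F_q-bilinear form
B(x, y) = Tr_{q^n/q}(x₀y₃ + x₃y₀ − x₁y₂ − x₂y₁) equals
{(x, y, β^{q^{n−I}}x^{q^{n−I}} + γ^{q^{n−J}}x^{q^{n−J}} − α^{q^{n−J}}y^{q^{n−J}},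
  y^{q^{n−I}} − x^{q^{n−J}}) : x, y ∈ F_{q^n}}. -/
theorem orthogonal_complement_of_Uspace
    (q n : ℕ) (Fq Fqn : Type*) [Field Fq] [Fintype Fq] [Field Fqn] [Algebra Fq Fqn]
    (hq : Fintype.card Fq = q) (hrank : Module.finrank Fq Fqn = n)
    (α β γ : Fqn) (hα : α ≠ 0) (hβ : β ≠ 0) (hγ : γ ≠ 0)
    (I J : ℕ) (hI : 0 < I) (hJ : 0 < J) (hIJ : I ≠ J)
    (hIn : I < n - 1) (hJn : J < n - 1) :
    {v : Fin 4 → Fqn | ∀ u ∈ Uset q α β γ I J,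
        Algebra.trace Fq Fqn (u 0 * v 3 + u 3 * v 0 - u 1 * v 2 - u 2 * v 1) = 0}
      = {w : Fin 4 → Fqn | ∃ x y : Fqn,
          w = ![x, y,
            β ^ q ^ (n - I) * x ^ q ^ (n - I) + γ ^ q ^ (n - J) * x ^ q ^ (n - J)
              - α ^ q ^ (n - J) * y ^ q ^ (n - J),
            y ^ q ^ (n - I) - x ^ q ^ (n - J)]} := by
  subst hq hrank
  have : FiniteDimensional Fq Fqn := FiniteDimensional.of_finrank_pos (by omega)
  have hI' : I ≤ Module.finrank Fq Fqn := by omega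
  have hJ' : J ≤ Module.finrank Fq Fqn := by omega
  ext v
  simp only [Set.mem_ofPred_eq]
  constructor
  · intro h
    have key (s t : Fqn) := (trace_Uvec hI' hJ' α β γ s t (v 0) (v 1) (v 2) (v 3)).symm.trans
      (h _ ⟨s, t, rfl⟩)
    have h3 := Algebra.eq_zero_of_trace_mul_eq_zero (K := Fq) fun s => by simpa using key s 0
    have h2 := Algebra.eq_zero_of_trace_mul_eq_zero (K := Fq) fun t => by
      simpa only [zero_mul, map_zero, zero_sub, neg_eq_zero] using key 0 t
    refine ⟨v 0, v 1, ?_⟩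
    simp only [← mul_pow, ← sub_eq_zero.mp h3, ← sub_eq_zero.mp h2]
    ext i
    fin_cases i <;> rfl
  · rintro ⟨x, y, rfl⟩ _ ⟨s, t, rfl⟩
    refine (trace_Uvec hI' hJ' α β γ s t x y _ _).trans ?_
    simp [mul_pow]
end
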